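/- Let X be a Hausdorff space and κ, λ infinite cardinals. If saL_c(X,λ) · t(X) ≤ κ, then saL_κ(X,λ) ≤ κ. -/

import Mathlib

open Cardinal Set

universe u

/-- Skew-λ Lindelöf degree of `A` in `X`. -/
noncomputable def skLrel (X : Type u) [TopologicalSpace X] (A : Set X) (lam : Cardinal.{u}) :
    Cardinal.{u} :=
  sInf {κ : Cardinal.{u} | ℵ₀ ≤ κ ∧
    ∀ 𝒰 : Set (Set X), (∀ U ∈ 𝒰, IsOpen U) → A ⊆ ⋃₀ 𝒰 →
      ∃ 𝒱 ⊆ 𝒰, #↥𝒱 ≤ κ ∧ #↥(A \ ⋃₀ 𝒱) < lam}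

/-- Skew-λ Lindelöf degree of `X`. -/
noncomputable def skL (X : Type u) [TopologicalSpace X] (lam : Cardinal.{u}) : Cardinal.{u} :=
  skLrel X Set.univ lam

/-- Lindelöf degree of `X`. -/
noncomputable def Ldeg (X : Type u) [TopologicalSpace X] : Cardinal.{u} :=
  sInf {κ : Cardinal.{u} | ℵ₀ ≤ κ ∧
    ∀ 𝒰 : Set (Set X), (∀ U ∈ 𝒰, IsOpen U) → ⋃₀ 𝒰 = Set.univ →
      ∃ 𝒱 ⊆ 𝒰, #↥𝒱 ≤ κ ∧ ⋃₀ 𝒱 = Set.univ}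

/-- Pseudocharacter of `X`. -/
noncomputable def psi (X : Type u) [TopologicalSpace X] : Cardinal.{u} :=
  sInf {κ : Cardinal.{u} | ℵ₀ ≤ κ ∧
    ∀ x : X, ∃ 𝒱 : Set (Set X), (∀ V ∈ 𝒱, IsOpen V) ∧ #↥𝒱 ≤ κ ∧ ⋂₀ 𝒱 = {x}}

/-- Closed pseudocharacter of `X`. -/
noncomputable def psic (X : Type u) [TopologicalSpace X] : Cardinal.{u} :=
  sInf {κ : Cardinal.{u} | ℵ₀ ≤ κ ∧
    ∀ x : X, ∃ 𝒱 : Set (Set X), (∀ V ∈ 𝒱, IsOpen V ∧ x ∈ V) ∧ #↥𝒱 ≤ κ ∧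
      (⋂ V ∈ 𝒱, closure V) = {x}}

/-- Tightness of `X`. -/
noncomputable def tight (X : Type u) [TopologicalSpace X] : Cardinal.{u} :=
  sInf {κ : Cardinal.{u} | ℵ₀ ≤ κ ∧
    ∀ (A : Set X) (x : X), x ∈ closure A → ∃ B ⊆ A, #↥B ≤ κ ∧ x ∈ closure B}

/-- Character of `X`. -/
noncomputable def charDeg (X : Type u) [TopologicalSpace X] : Cardinal.{u} :=
  sInf {κ : Cardinal.{u} | ℵ₀ ≤ κ ∧
    ∀ x : X, ∃ ℬ : Set (Set X), (∀ B ∈ ℬ, IsOpen B ∧ x ∈ B) ∧ #↥ℬ ≤ κ ∧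
      ∀ U : Set X, IsOpen U → x ∈ U → ∃ B ∈ ℬ, B ⊆ U}

/-- Density of `X`. -/
noncomputable def dens (X : Type u) [TopologicalSpace X] : Cardinal.{u} :=
  sInf {κ : Cardinal.{u} | ℵ₀ ≤ κ ∧ ∃ D : Set X, Dense D ∧ #↥D ≤ κ}

/-- θ-network weight of `X`. -/
noncomputable def nwTheta (X : Type u) [TopologicalSpace X] : Cardinal.{u} :=
  sInf {κ : Cardinal.{u} | ℵ₀ ≤ κ ∧
    ∃ 𝒩 : Set (Set X), 𝒩.Nonempty ∧ #↥𝒩 ≤ κ ∧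
      ∀ (x : X) (U : Set X), IsOpen U → x ∈ U → ∃ N ∈ 𝒩, x ∈ N ∧ N ⊆ closure U}

/-- Skew-λ almost Lindelöf degree of `A` in `X`. -/
noncomputable def saLrel (X : Type u) [TopologicalSpace X] (A : Set X) (lam : Cardinal.{u}) :
    Cardinal.{u} :=
  sInf {κ : Cardinal.{u} | ℵ₀ ≤ κ ∧
    ∀ 𝒰 : Set (Set X), (∀ U ∈ 𝒰, IsOpen U) → A ⊆ ⋃₀ 𝒰 →
      ∃ 𝒱 ⊆ 𝒰, #↥𝒱 ≤ κ ∧ #↥(A \ ⋃ V ∈ 𝒱, closure V) < lam}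

/-- Skew-λ almost Lindelöf degree of `X`. -/
noncomputable def saL (X : Type u) [TopologicalSpace X] (lam : Cardinal.{u}) : Cardinal.{u} :=
  saLrel X Set.univ lam

/-- Skew-λ almost Lindelöf degree of `X` with respect to closed sets. -/
noncomputable def saLc (X : Type u) [TopologicalSpace X] (lam : Cardinal.{u}) : Cardinal.{u} :=
  sSup {c : Cardinal.{u} | ∃ A : Set X, IsClosed A ∧ c = saLrel X A lam}

/-- κ-closure of a set. -/
def clk {X : Type u} [TopologicalSpace X] (κ : Cardinal.{u}) (A : Set X) : Set X :=
  ⋃ B ∈ {B : Set X | B ⊆ A ∧ #↥B ≤ κ}, closure B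

/-- Skew-λ almost Lindelöf degree of `X` with respect to κ-closed sets. -/
noncomputable def saLk (X : Type u) [TopologicalSpace X] (κ lam : Cardinal.{u}) : Cardinal.{u} :=
  sSup {c : Cardinal.{u} | ∃ A : Set X, clk κ A = A ∧ c = saLrel X A lam}

/-- Skew-λ weak Lindelöf degree of `A` in `X`. -/
noncomputable def swLrel (X : Type u) [TopologicalSpace X] (A : Set X) (lam : Cardinal.{u}) :
    Cardinal.{u} :=
  sInf {κ : Cardinal.{u} | ℵ₀ ≤ κ ∧
    ∀ 𝒰 : Set (Set X), (∀ U ∈ 𝒰, IsOpen U) → A ⊆ ⋃₀ 𝒰 →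
      ∃ 𝒱 ⊆ 𝒰, #↥𝒱 ≤ κ ∧ #↥(A \ closure (⋃₀ 𝒱)) < lam}

/-- Skew-λ weak Lindelöf degree of `X`. -/
noncomputable def swL (X : Type u) [TopologicalSpace X] (lam : Cardinal.{u}) : Cardinal.{u} :=
  swLrel X Set.univ lam

/-- Skew-λ weak Lindelöf degree of `X` with respect to closed sets. -/
noncomputable def swLc (X : Type u) [TopologicalSpace X] (lam : Cardinal.{u}) : Cardinal.{u} :=
  sSup {c : Cardinal.{u} | ∃ A : Set X, IsClosed A ∧ c = swLrel X A lam}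

/-- Proposition 4.2(f): if saL_c(X,λ)·t(X) ≤ κ, then saL_κ(X,λ) ≤ κ. -/
theorem saLk_le_of_saLc_mul_tight_le {X : Type u} [TopologicalSpace X] [T2Space X]
    (κ lam : Cardinal.{u}) (hκ : ℵ₀ ≤ κ) (hlam : ℵ₀ ≤ lam)
    (h : saLc X lam * tight X ≤ κ) :
    saLk X κ lam ≤ κ := by
  -- the defining set of the tightness is nonempty
  have htne : {κ : Cardinal.{u} | ℵ₀ ≤ κ ∧
      ∀ (A : Set X) (x : X), x ∈ closure A →
        ∃ B ⊆ A, #↥B ≤ κ ∧ x ∈ closure B}.Nonempty :=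
    ⟨max ℵ₀ #X, le_max_left _ _, fun A x hx =>
      ⟨A, subset_rfl, (mk_set_le A).trans (le_max_right _ _), hx⟩⟩
  obtain ⟨ht0, ht⟩ := csInf_mem htne
  change ℵ₀ ≤ tight X at ht0
  -- the defining set of each relative degree is nonempty, with a uniform bound
  have hmem : ∀ A : Set X, max ℵ₀ #(Set X) ∈ {κ : Cardinal.{u} | ℵ₀ ≤ κ ∧
      ∀ 𝒰 : Set (Set X), (∀ U ∈ 𝒰, IsOpen U) → A ⊆ ⋃₀ 𝒰 →
        ∃ 𝒱 ⊆ 𝒰, #↥𝒱 ≤ κ ∧ #↥(A \ ⋃ V ∈ 𝒱, closure V) < lam} := by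
    intro A
    refine ⟨le_max_left _ _, fun 𝒰 _ hA =>
      ⟨𝒰, subset_rfl, (mk_set_le 𝒰).trans (le_max_right _ _), ?_⟩⟩
    have he : A \ ⋃ V ∈ 𝒰, closure V = ∅ := by
      rw [Set.diff_eq_empty]
      intro x hx
      obtain ⟨U, hU, hxU⟩ := hA hx
      exact Set.mem_biUnion hU (subset_closure hxU)
    rw [he, mk_emptyCollection]
    exact aleph0_pos.trans_le hlam
  have hbdd : BddAbove {c : Cardinal.{u} | ∃ A : Set X, IsClosed A ∧ c = saLrel X A lam} := by
    refine ⟨max ℵ₀ #(Set X), ?_⟩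
    rintro c ⟨A, _, rfl⟩
    exact csInf_le' (hmem A)
  have hle : ∀ A : Set X, IsClosed A → saLrel X A lam ≤ saLc X lam :=
    fun A hA => le_csSup hbdd ⟨A, hA, rfl⟩
  have hs0 : ℵ₀ ≤ saLc X lam :=
    (csInf_mem ⟨_, hmem ∅⟩).1.trans (hle ∅ isClosed_empty)
  have hsκ : saLc X lam ≤ κ :=
    (le_mul_right (aleph0_pos.trans_le ht0).ne').trans h
  have htκ : tight X ≤ κ :=
    (le_mul_left (aleph0_pos.trans_le hs0).ne').trans h
  refine csSup_le' ?_
  rintro c ⟨A, hA, rfl⟩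
  refine (hle A ?_).trans hsκ
  refine isClosed_of_closure_subset fun x hx => ?_
  obtain ⟨B, hBA, hB, hxB⟩ := ht A x hx
  rw [← hA]
  exact Set.mem_biUnion (show B ∈ {B : Set X | B ⊆ A ∧ #↥B ≤ κ} from ⟨hBA, hB.trans htκ⟩) hxB
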